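/- Let n ≥ 2 be an integer and s > n/2 a real number. For θ₀ ∈ (0, π), the number s(s + 1 − n) is an eigenvalue of L_s on [0, θ₀] if and only if θ₀ = π/2. Moreover, when θ₀ = π/2, the function u(θ) = sin(θ)^{2s−n} satisfies L_s u = s(s + 1 − n)·u on (0, π/2) and u'(π/2) = 0. -/

import Mathlib

open Real Set Filter

/-- The operator `(L_s u)(θ) = -u''(θ) - (n+1-2s) cot(θ) u'(θ) + (s-1)(s-n) u(θ)`. -/
noncomputable def Ls (n : ℕ) (s : ℝ) (u : ℝ → ℝ) (θ : ℝ) : ℝ :=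
  -deriv (deriv u) θ - ((n : ℝ) + 1 - 2 * s) * Real.cot θ * deriv u θ
    + (s - 1) * (s - (n : ℝ)) * u θ

/-- `lam` is an eigenvalue of `L_s` on `[0, θ₀]`: there is `v`, the restriction of a
`C^∞` function on `ℝ`, not identically zero on `[0, θ₀]`, such that
`u(θ) = sin(θ)^{2s-n} v(θ)` satisfies `L_s u = lam·u` on `(0, θ₀)` and `u'(θ₀) = 0`. -/
def IsEigenvalue (n : ℕ) (s θ₀ lam : ℝ) : Prop :=
  ∃ V : ℝ → ℝ, ContDiff ℝ (⊤ : ℕ∞) V ∧ (∃ θ ∈ Set.Icc 0 θ₀, V θ ≠ 0) ∧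
    (∀ θ ∈ Set.Ioo 0 θ₀,
      Ls n s (fun t => Real.sin t ^ (2 * s - (n : ℝ)) * V t) θ
        = lam * (Real.sin θ ^ (2 * s - (n : ℝ)) * V θ)) ∧
    deriv (fun t => Real.sin t ^ (2 * s - (n : ℝ)) * V t) θ₀ = 0

lemma hasDerivAt_sin_rpow_mul {V : ℝ → ℝ} {V' a θ : ℝ} (hV : HasDerivAt V V' θ)
    (h : 0 < sin θ) :
    HasDerivAt (fun t => sin t ^ a * V t)
      (sin θ ^ a * V' + a * (sin θ ^ (a - 1) * (cos θ * V θ))) θ := by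
  have h1 := ((hasDerivAt_sin θ).rpow_const (p := a) (Or.inl h.ne')).mul hV
  refine h1.congr_deriv ?_
  ring

lemma Ls_sin_rpow_mul (n : ℕ) (s : ℝ) {V : ℝ → ℝ} (hV : ContDiff ℝ (⊤ : ℕ∞) V) {θ : ℝ}
    (hθ : θ ∈ Ioo 0 π) :
    Ls n s (fun t => sin t ^ (2 * s - (n : ℝ)) * V t) θ
      = s * (s + 1 - (n : ℝ)) * (sin θ ^ (2 * s - (n : ℝ)) * V θ)
        - sin θ ^ (2 * s - (n : ℝ))
          * (deriv (deriv V) θ + (1 + (2 * s - (n : ℝ))) * cot θ * deriv V θ) := by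
  have hsin : 0 < sin θ := sin_pos_of_mem_Ioo hθ
  have hV1 : ∀ t, HasDerivAt V (deriv V t) t := fun t =>
    (hV.differentiable (by simp) t).hasDerivAt
  have hV2 : HasDerivAt (deriv V) (deriv (deriv V) θ) θ :=
    ((contDiff_infty_iff_deriv.1 hV).2.differentiable (by simp) θ).hasDerivAt
  obtain ⟨a, ha⟩ : ∃ a, a = 2 * s - (n : ℝ) := ⟨_, rfl⟩
  have hn : (n : ℝ) = 2 * s - a := by linarith
  rw [← ha]
  have hd2 : deriv (deriv fun t => sin t ^ a * V t) θ
      = (sin θ ^ a * deriv (deriv V) θ + a * (sin θ ^ (a - 1) * (cos θ * deriv V θ)))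
        + a * (sin θ ^ (a - 1) * (-sin θ * V θ + cos θ * deriv V θ)
          + (a - 1) * (sin θ ^ (a - 1 - 1) * (cos θ * (cos θ * V θ)))) := by
    have hev : deriv (fun t => sin t ^ a * V t) =ᶠ[nhds θ]
        fun t => sin t ^ a * deriv V t + a * (sin t ^ (a - 1) * (cos t * V t)) := by
      filter_upwards [isOpen_Ioo.mem_nhds hθ] with t ht
      exact (hasDerivAt_sin_rpow_mul (hV1 t) (sin_pos_of_mem_Ioo ht)).deriv
    rw [hev.deriv_eq]
    exact ((hasDerivAt_sin_rpow_mul hV2 hsin).add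
      ((hasDerivAt_sin_rpow_mul ((hasDerivAt_cos θ).mul (hV1 θ)) hsin).const_mul a)).deriv
  rw [Ls, hd2, (hasDerivAt_sin_rpow_mul (hV1 θ) hsin).deriv, cot_eq_cos_div_sin, hn]
  simp only [rpow_sub_one hsin.ne']
  field_simp
  ring

/-- A `C^∞` solution of `v'' + (1 + a) cot(θ) v' = 0` on `(0, θ₀)` has `v' = 0` on `(0, θ₀)`. -/
lemma deriv_eq_zero_of_ode {V : ℝ → ℝ} (hV : ContDiff ℝ (⊤ : ℕ∞) V) {a θ₀ : ℝ} (ha : 0 < a)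
    (hθ₀ : θ₀ ∈ Ioo 0 π)
    (hode : ∀ θ ∈ Ioo 0 θ₀, deriv (deriv V) θ + (1 + a) * cot θ * deriv V θ = 0) :
    ∀ θ ∈ Icc 0 θ₀, deriv V θ = 0 := by
  have hV' : ContDiff ℝ (⊤ : ℕ∞) (deriv V) := (contDiff_infty_iff_deriv.1 hV).2
  have hc : Continuous (fun t => sin t ^ (1 + a) * deriv V t) :=
    (continuous_sin.rpow_const fun _ => Or.inr (by linarith)).mul hV'.continuous
  have hzero : ∀ θ ∈ Ioc 0 θ₀, deriv V θ = 0 := by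
    intro θ hθ
    have hsin : 0 < sin θ := sin_pos_of_pos_of_lt_pi hθ.1 (hθ.2.trans_lt hθ₀.2)
    have hmul : sin θ ^ (1 + a) * deriv V θ = sin 0 ^ (1 + a) * deriv V 0 := by
      obtain ⟨c, hc', hslope⟩ := exists_deriv_eq_slope
        (fun t => sin t ^ (1 + a) * deriv V t) hθ.1 hc.continuousOn (fun t ht =>
          (hasDerivAt_sin_rpow_mul (hV'.differentiable (by simp) t).hasDerivAt
            (sin_pos_of_pos_of_lt_pi ht.1
              (ht.2.trans_le (hθ.2.trans hθ₀.2.le)))).differentiableAt.differentiableWithinAt)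
      have hsc : 0 < sin c :=
        sin_pos_of_pos_of_lt_pi hc'.1 (hc'.2.trans_le (hθ.2.trans hθ₀.2.le))
      have hz : deriv (fun t => sin t ^ (1 + a) * deriv V t) c = 0 := by
        rw [(hasDerivAt_sin_rpow_mul (hV'.differentiable (by simp) c).hasDerivAt hsc).deriv,
          rpow_sub_one hsc.ne']
        have := hode c ⟨hc'.1, hc'.2.trans_le hθ.2⟩
        rw [cot_eq_cos_div_sin] at this
        linear_combination sin c ^ (1 + a) * this
      rw [hz, eq_comm, div_eq_zero_iff] at hslope
      rcases hslope with h | h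
      · linarith
      · linarith [hθ.1]
    rw [sin_zero, zero_rpow (by linarith), zero_mul] at hmul
    exact (mul_eq_zero.1 hmul).resolve_left (rpow_pos_of_pos hsin _).ne'
  have hcl : Icc 0 θ₀ ⊆ {θ | deriv V θ = 0} := by
    rw [← closure_Ioc hθ₀.1.ne]
    exact closure_minimal hzero (isClosed_eq hV'.continuous continuous_const)
  exact hcl

/-- `s(s+1-n)` is an eigenvalue of `L_s` on `[0, θ₀]` iff `θ₀ = π/2`;
moreover `u(θ) = sin(θ)^{2s-n}` satisfies `L_s u = s(s+1-n) u` on `(0, π/2)` and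
`u'(π/2) = 0`. -/
theorem stmt_4 (n : ℕ) (hn : 2 ≤ n) (s : ℝ) (hs : (n : ℝ) / 2 < s)
    (θ₀ : ℝ) (hθ₀ : θ₀ ∈ Set.Ioo 0 Real.pi) :
    (IsEigenvalue n s θ₀ (s * (s + 1 - (n : ℝ))) ↔ θ₀ = Real.pi / 2) ∧
    (∀ θ ∈ Set.Ioo 0 (Real.pi / 2),
      Ls n s (fun t => Real.sin t ^ (2 * s - (n : ℝ))) θ
        = s * (s + 1 - (n : ℝ)) * Real.sin θ ^ (2 * s - (n : ℝ))) ∧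
    deriv (fun t => Real.sin t ^ (2 * s - (n : ℝ))) (Real.pi / 2) = 0 := by
  have ha : 0 < 2 * s - (n : ℝ) := by linarith
  have hL : ∀ θ ∈ Ioo 0 π, Ls n s (fun t => sin t ^ (2 * s - (n : ℝ))) θ
      = s * (s + 1 - (n : ℝ)) * sin θ ^ (2 * s - (n : ℝ)) := fun θ hθ => by
    simpa using Ls_sin_rpow_mul n s (V := fun _ => 1) contDiff_const hθ
  have hd : deriv (fun t => sin t ^ (2 * s - (n : ℝ))) (π / 2) = 0 := by
    simp
  refine ⟨⟨?_, ?_⟩, fun θ hθ => hL θ ⟨hθ.1, hθ.2.trans (by linarith [pi_pos])⟩, hd⟩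
  · rintro ⟨V, hV, ⟨x, hx, hVx⟩, heq, hbd⟩
    have hV' := deriv_eq_zero_of_ode hV ha hθ₀ fun θ hθ => by
      have hθ' : θ ∈ Ioo 0 π := ⟨hθ.1, hθ.2.trans hθ₀.2⟩
      have h := heq θ hθ
      rw [Ls_sin_rpow_mul n s hV hθ', sub_eq_self] at h
      exact (mul_eq_zero.1 h).resolve_left (rpow_pos_of_pos (sin_pos_of_mem_Ioo hθ') _).ne'
    have hVd := hV.differentiable (by simp)
    have hconst : ∀ y ∈ Icc 0 θ₀, V y = V 0 :=
      constant_of_has_deriv_right_zero hV.continuous.continuousOn fun y hy => by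
        have := (hVd y).hasDerivAt
        rw [hV' y ⟨hy.1, hy.2.le⟩] at this
        exact this.hasDerivWithinAt
    have hsin : 0 < sin θ₀ := sin_pos_of_mem_Ioo hθ₀
    have hVθ₀ : V θ₀ ≠ 0 := by
      rwa [hconst θ₀ ⟨hθ₀.1.le, le_rfl⟩, ← hconst x hx]
    rw [(hasDerivAt_sin_rpow_mul (hVd θ₀).hasDerivAt hsin).deriv,
      hV' θ₀ ⟨hθ₀.1.le, le_rfl⟩, mul_zero, zero_add] at hbd
    have hcos : cos θ₀ = 0 := by
      simpa [ha.ne', (rpow_pos_of_pos hsin _).ne', hVθ₀] using hbd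
    refine injOn_cos ⟨hθ₀.1.le, hθ₀.2.le⟩ ⟨by positivity, by linarith [pi_pos]⟩ ?_
    rw [hcos, cos_pi_div_two]
  · rintro rfl
    refine ⟨fun _ => 1, contDiff_const, ⟨0, ⟨le_rfl, by positivity⟩, one_ne_zero⟩, ?_, ?_⟩
    · intro θ hθ
      simpa using hL θ ⟨hθ.1, hθ.2.trans (by linarith [pi_pos])⟩
    · simp
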